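/- Let 𝒫 be a graded poset, 𝒥 a local covering family for 𝒫, and F : 𝒫 → Ab an n-condensed, free, 𝒥-determined functor, with short exact sequence 0 → F → Ker'_F → G → 0. If for each object p₀ with deg(p₀) ≥ n+1 one has rk F(p₀) = Σ_{p ∈ J_n^{p₀}} rk F(p), then G is (n+1)-condensed, free and 𝒥-determined. -/

import Mathlib

open Finset

/-- A graded poset (with the standing assumptions of Remark 2.5: the degree function is
order-reversing, adds one along preceding pairs, takes nonnegative values, and every
up-set is finite). -/
structure GradedPoset (P : Type) [PartialOrder P] : Type where
  deg : P → ℤ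
  deg_antitone : ∀ ⦃p q : P⦄, p ≤ q → deg q ≤ deg p
  deg_step : ∀ ⦃p q : P⦄, p < q → (∀ r, p ≤ r → r ≤ q → r = p ∨ r = q) → deg p = deg q + 1
  deg_nonneg : ∀ p, 0 ≤ deg p
  finite_up : ∀ p : P, {q : P | p ≤ q}.Finite

/-- A functor from a poset `P` to the category `Ab` of abelian groups. -/
structure PosetFunctor (P : Type) [PartialOrder P] : Type 1 where
  obj : P → Type
  grp : ∀ p, AddCommGroup (obj p)
  map : ∀ {p q : P}, p ≤ q → obj p →+ obj q
  map_id : ∀ (p : P) (x : obj p), map (le_refl p) x = x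
  map_comp : ∀ {p q r : P} (h₁ : p ≤ q) (h₂ : q ≤ r) (x : obj p),
    map h₂ (map h₁ x) = map (h₁.trans h₂) x

attribute [instance] PosetFunctor.grp

variable {P : Type} [PartialOrder P]

/-- A natural transformation between functors `P → Ab`. -/
structure PosetHom (F G : PosetFunctor P) : Type where
  app : ∀ p : P, F.obj p →+ G.obj p
  naturality : ∀ {p q : P} (h : p ≤ q) (x : F.obj p),
    G.map h (app p x) = app q (F.map h x)

/-- The constant functor with value `ℤ`. -/
def constZ (P : Type) [PartialOrder P] : PosetFunctor P where
  obj _ := ℤ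
  grp _ := inferInstance
  map _ := AddMonoidHom.id ℤ
  map_id _ _ := rfl
  map_comp _ _ _ := rfl

namespace PosetFunctor

/-- The inverse limit `lim F` of `F : P → Ab`, realized as the group of compatible
families (sections). -/
def sections (F : PosetFunctor P) : AddSubgroup (∀ p, F.obj p) where
  carrier := {x | ∀ (p q : P) (h : p ≤ q), F.map h (x p) = x q}
  zero_mem' := by intro p q h; simp
  add_mem' := by intro a b ha hb p q h; simp [map_add, ha p q h, hb p q h]
  neg_mem' := by intro a ha p q h; simp [ha p q h]

/-- The functor `F'` with `F'(p₀) = ∏_{p₀ ≤ p} F(p)`; a morphism `p₁ ≤ p₀` acts by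
sending the factor indexed by `p₁ ≤ p` identically to the factor indexed by `p₀ ≤ p`
when `p₀ ≤ p`, and by zero otherwise. -/
def prime (F : PosetFunctor P) : PosetFunctor P where
  obj p₀ := ∀ q : {q : P // p₀ ≤ q}, F.obj q.1
  grp _ := inferInstance
  map h := AddMonoidHom.mk' (fun x q => x ⟨q.1, h.trans q.2⟩) (fun _ _ => rfl)
  map_id _ _ := rfl
  map_comp _ _ _ := rfl

end PosetFunctor

/-- The subgroup `Ker_F(p₀) = ⋂_{p₀ < q} Ker (F(p₀ → q))`. -/
def kerAt (F : PosetFunctor P) (p₀ : P) : AddSubgroup (F.obj p₀) where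
  carrier := {x | ∀ (q : P) (h : p₀ < q), F.map h.le x = 0}
  zero_mem' := by intro q h; simp
  add_mem' := by intro a b ha hb q h; simp [map_add, ha q h, hb q h]
  neg_mem' := by intro a ha q h; simp [ha q h]

/-- `F` is `n`-condensed: `F(p) = 0` for `deg p < n` and `Ker_F(p) = 0` for `deg p > n`. -/
def IsCondensed (G : GradedPoset P) (F : PosetFunctor P) (n : ℕ) : Prop :=
  (∀ p : P, G.deg p < (n : ℤ) → ∀ x : F.obj p, x = 0) ∧
  (∀ p : P, (n : ℤ) < G.deg p → ∀ x ∈ kerAt F p, x = 0)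

/-- The set `(p₀ ↓ P)_n` of objects above `p₀` of degree `n`. -/
def degSet (G : GradedPoset P) (p₀ : P) (n : ℕ) : Set P :=
  {q : P | p₀ ≤ q ∧ G.deg q = (n : ℤ)}

/-- The functor `Ker'_F` (for an `n`-condensed functor `F`):
`Ker'_F(p₀) = ∏_{p ∈ (p₀↓P)_n} F(p)`. -/
def kerPrime (G : GradedPoset P) (F : PosetFunctor P) (n : ℕ) : PosetFunctor P where
  obj p₀ := ∀ q : degSet G p₀ n, F.obj q.1
  grp _ := inferInstance
  map h := AddMonoidHom.mk' (fun x q => x ⟨q.1, h.trans q.2.1, q.2.2⟩) (fun _ _ => rfl)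
  map_id _ _ := rfl
  map_comp _ _ _ := rfl

/-- The natural transformation `λ : F ⇒ Ker'_F` with components
`λ_{p₀} = ∏_{p ∈ (p₀↓P)_n} F(p₀ → p)`. -/
def lambdaNT (G : GradedPoset P) (F : PosetFunctor P) (n : ℕ) :
    PosetHom F (kerPrime G F n) where
  app p₀ := AddMonoidHom.mk' (fun x q => F.map q.2.1 x)
    (by intro a b; funext q; exact map_add _ a b)
  naturality := by
    intro p q h x
    funext r
    exact (F.map_comp h r.2.1 x).symm

/-! ### The cochain complex computing higher inverse limits -/

/-- Composable chains `p₀ ≤ p₁ ≤ … ≤ pₙ` in `P`. -/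
def ChainP (P : Type) [PartialOrder P] (n : ℕ) : Type :=
  {c : Fin (n + 1) → P // Monotone c}

/-- `n`-cochains of the cobar complex computing the derived functors of `lim` over `P`
with coefficients in `F`. -/
abbrev cochain (F : PosetFunctor P) (n : ℕ) : Type :=
  ∀ c : ChainP P n, F.obj (c.1 (Fin.last n))

/-- The `i`-th face of a chain. -/
def chainFace {n : ℕ} (i : Fin (n + 2)) (c : ChainP P (n + 1)) : ChainP P n :=
  ⟨c.1 ∘ i.succAbove, c.2.comp (Fin.strictMono_succAbove i).monotone⟩

/-- The differential of the cobar complex. -/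
noncomputable def cobarDiff (F : PosetFunctor P) (n : ℕ) : cochain F n →+ cochain F (n + 1) :=
  AddMonoidHom.mk'
    (fun ψ c => ∑ i : Fin (n + 2),
      ((-1 : ℤ) ^ (i : ℕ)) • F.map (c.2 (Fin.le_last (i.succAbove (Fin.last n))))
        (ψ (chainFace i c)))
    (by
      intro a b; funext c
      simp only [Pi.add_apply]
      refine Eq.trans ?_ Finset.sum_add_distrib
      refine Finset.sum_congr rfl fun i _ => ?_
      exact (congrArg _ (map_add (F.map _) _ _)).trans (smul_add _ _ _))

/-- Coboundaries of the cobar complex. -/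
noncomputable def cobarCoboundaries (F : PosetFunctor P) : ∀ n : ℕ, AddSubgroup (cochain F n)
  | 0 => ⊥
  | n + 1 => (cobarDiff F n).range

/-- `H^n(P; F) = lim^n F`, the cohomology of `P` with coefficients in `F`, computed by
the cobar complex. -/
noncomputable def cohomologyOf (F : PosetFunctor P) (n : ℕ) : Type :=
  (cobarDiff F n).ker ⧸ ((cobarCoboundaries F n).addSubgroupOf (cobarDiff F n).ker)

noncomputable instance (F : PosetFunctor P) (n : ℕ) : AddCommGroup (cohomologyOf F n) :=
  inferInstanceAs (AddCommGroup (_ ⧸ _))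

/-- The `n`-th Betti number of `P` with coefficients in `F`: the rank of `H^n(P;F)`. -/
noncomputable def bettiOf (F : PosetFunctor P) (n : ℕ) : ℕ :=
  Module.finrank ℤ (cohomologyOf F n)

/-! ### Free functors, pure maps, local covering families -/

/-- A functor is free if all its values are finitely generated free abelian groups. -/
def IsFreeFunctor (F : PosetFunctor P) : Prop :=
  ∀ p : P, Module.Free ℤ (F.obj p) ∧ Module.Finite ℤ (F.obj p)

/-- A map of abelian groups is pure if its cokernel is a free abelian group. -/
def IsPureHom {A B : Type} [AddCommGroup A] [AddCommGroup B] (f : A →+ B) : Prop :=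
  Module.Free ℤ (B ⧸ f.range)

/-- Sections of `F` over a subset `S ⊆ P`, i.e. `lim_S F`. -/
def sectionsOnSet (F : PosetFunctor P) (S : Set P) : Set (∀ q : S, F.obj q.1) :=
  {x | ∀ (q r : S) (h : q.1 ≤ r.1), F.map h (x q) = x r}

/-- The restriction map `lim_{(p₀↓P)_*} F → ∏_{q ∈ S} F(q)` (for `S` a set of objects
strictly above `p₀`, realized by intersecting with `{q | p₀ < q}`). -/
def limRestriction (F : PosetFunctor P) (p₀ : P) (S : Set P) :
    ↥(sectionsOnSet F {q : P | p₀ < q}) → ∀ q : ↥(S ∩ {q : P | p₀ < q}), F.obj q.1 :=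
  fun x q => x.1 ⟨q.1, q.2.2⟩

/-- The map `F(p₀) → ∏_{q ∈ S} F(q)` (for `S` a set of objects above `p₀`, realized by
intersecting with `{q | p₀ ≤ q}`). -/
def detMap (F : PosetFunctor P) (p₀ : P) (S : Set P) :
    F.obj p₀ →+ ∀ q : ↥(S ∩ {q : P | p₀ ≤ q}), F.obj q.1 :=
  AddMonoidHom.mk' (fun x q => F.map q.2.2 x) (by intro a b; funext q; exact map_add _ a b)

/-- A local covering family `𝒥 = {J_n^{p₀}}` (Definition 3.4). -/
def IsLCF (G : GradedPoset P) (J : P → ℕ → Set P) : Prop :=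
  (∀ (p : P) (m : ℕ), J p m ⊆ degSet G p m) ∧
  (∀ (p : P) (m : ℕ), (m : ℤ) < G.deg p →
    (⋃ r ∈ J p (m + 1), degSet G r m) = degSet G p m) ∧
  (∀ (p : P) (m : ℕ), ∀ r ∈ J p (m + 1), J r m ⊆ J p m)

/-- `F` (an `n`-condensed free functor) is `𝒥`-determined (Definition 3.5). -/
def IsDetermined (G : GradedPoset P) (J : P → ℕ → Set P) (F : PosetFunctor P) (n : ℕ) :
    Prop :=
  (∀ p₀ : P, (n : ℤ) + 1 < G.deg p₀ →
    Function.Injective (limRestriction F p₀ (J p₀ n)) ∧ IsPureHom (detMap F p₀ (J p₀ n))) ∧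
  (∀ p₀ : P, G.deg p₀ = (n : ℤ) + 1 →
    IsPureHom (detMap F p₀ (J p₀ n)) ∧ Function.Injective (detMap F p₀ (J p₀ n)))

/-- The finite set `(p↓P)_n`. -/
noncomputable def degFinset (G : GradedPoset P) (p : P) (n : ℕ) : Finset P :=
  ((G.finite_up p).subset
    (show degSet G p n ⊆ {q : P | p ≤ q} from fun _ hq => hq.1)).toFinset

/-- The numbers `R_n^{p₀}` (Definition 4.1). -/
noncomputable def Rnum (G : GradedPoset P) : ℕ → P → ℤ
  | 0, _ => 1
  | m + 1, p => (∑ q ∈ degFinset G p m, Rnum G m q) - Rnum G m p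

/-- The finite set `J_n^p` (as a `Finset`, using finiteness of up-sets). -/
noncomputable def JFinset (G : GradedPoset P) (J : P → ℕ → Set P) (p : P) (n : ℕ) :
    Finset P :=
  ((G.finite_up p).inter_of_left (J p n)).toFinset

/-- Connectedness of a subset of a poset, viewed as a full subcategory. -/
def IsConnectedSet (S : Set P) : Prop :=
  S.Nonempty ∧ ∀ a b : S, Relation.ReflTransGen (fun x y : S => x.1 ≤ y.1 ∨ y.1 ≤ x.1) a b

/-- An adequate local covering family (Definition 4.2). -/
def IsAdequate (G : GradedPoset P) (J : P → ℕ → Set P) : Prop :=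
  IsLCF G J ∧
  (∀ p : P, 2 ≤ G.deg p → IsConnectedSet {q : P | p < q}) ∧
  (∀ (m : ℕ) (p : P), (m : ℤ) + 1 ≤ G.deg p →
    Rnum G m p = ∑ q ∈ JFinset G J p m, Rnum G m q)

/-! ### The global complex and global covering families -/

/-- Restriction of a product of abelian groups to a subset of the index set. -/
def restrictTo {ι : Type} {A : ι → Type} [∀ i, AddCommGroup (A i)] (S : Set ι) :
    (∀ i, A i) →+ ∀ i : S, A i.1 :=
  AddMonoidHom.mk' (fun x i => x i.1) (fun _ _ => rfl)

open Classical in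
/-- Extension by zero of a family indexed by a subset of the index set. -/
noncomputable def extendZero {ι : Type} {A : ι → Type} [∀ i, AddCommGroup (A i)]
    (S : Set ι) : (∀ i : S, A i.1) →+ ∀ i, A i :=
  AddMonoidHom.mk' (fun x i => if h : i ∈ S then x ⟨i, h⟩ else 0)
    (by intro a b; funext i; by_cases h : i ∈ S <;> simp [h])

/-- The map on full products induced by a natural transformation
`π : Ker'_F ⇒ F'` (the building block of the differential `d = ι ∘ ω`). -/
noncomputable def dhat (G : GradedPoset P) {F F' : PosetFunctor P} (n : ℕ)
    (π : PosetHom (kerPrime G F n) F') : (∀ p : P, F.obj p) →+ ∀ p : P, F'.obj p :=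
  AddMonoidHom.mk' (fun x p => π.app p (fun q => x q.1))
    (by intro a b; funext p; exact map_add (π.app p) _ _)

/-- The set `Ob_n(P)` of objects of degree `n`. -/
def obSet (G : GradedPoset P) (n : ℕ) : Set P := {p : P | G.deg p = (n : ℤ)}

/-- The differential `d_n = ι_{n+1} ∘ ω_{n+1} : ∏_{Ob_n} F_n(p) → ∏_{Ob_{n+1}} F_{n+1}(p)`. -/
noncomputable def obDiff (G : GradedPoset P) (F : ℕ → PosetFunctor P)
    (π : ∀ n : ℕ, PosetHom (kerPrime G (F n) n) (F (n + 1))) (n : ℕ) :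
    (∀ p : ↥(obSet G n), (F n).obj p.1) →+ ∀ p : ↥(obSet G (n + 1)), (F (n + 1)).obj p.1 :=
  (restrictTo (obSet G (n + 1))).comp ((dhat G n (π n)).comp (extendZero (obSet G n)))

/-- The composite `∏_{p ∈ Ob_n(P)∖K_n} F_n(p) → ∏_{p ∈ K_{n+1}} F_{n+1}(p)`
induced by the differential. -/
noncomputable def wMap (G : GradedPoset P) (F : ℕ → PosetFunctor P)
    (π : ∀ n : ℕ, PosetHom (kerPrime G (F n) n) (F (n + 1))) (K : ℕ → Set P) (n : ℕ) :
    (∀ p : ↥(obSet G n \ K n), (F n).obj p.1) →+ ∀ p : ↥(K (n + 1)), (F (n + 1)).obj p.1 :=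
  (restrictTo (K (n + 1))).comp ((dhat G n (π n)).comp (extendZero (obSet G n \ K n)))

/-- A global covering family (Definition 5.1). -/
def IsGCF (G : GradedPoset P) (F : ℕ → PosetFunctor P)
    (π : ∀ n : ℕ, PosetHom (kerPrime G (F n) n) (F (n + 1))) (K : ℕ → Set P) : Prop :=
  (∀ n : ℕ, K n ⊆ obSet G n) ∧
  (∀ n : ℕ, Function.Injective
    (fun (s : ↥(PosetFunctor.sections (F n))) => (fun p : ↥(K n) => s.1 p.1))) ∧
  (∀ n : ℕ, IsPureHom (wMap G F π K n))

/-- `Ob_n(P)` as a `Finset` (given that each degree level is finite). -/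
noncomputable def obFinset (G : GradedPoset P)
    (hfin : ∀ i : ℤ, {p : P | G.deg p = i}.Finite) (n : ℕ) : Finset P :=
  (hfin (n : ℤ)).toFinset

/-- `K_n` as a `Finset`. -/
noncomputable def KFinset (G : GradedPoset P)
    (hfin : ∀ i : ℤ, {p : P | G.deg p = i}.Finite) (K : ℕ → Set P) (n : ℕ) : Finset P :=
  ((hfin (n : ℤ)).inter_of_left (K n)).toFinset

/-- The Betti numbers `b_n^𝒦` of a global covering family (Definition 5.2). -/
noncomputable def bettiK (G : GradedPoset P)
    (hfin : ∀ i : ℤ, {p : P | G.deg p = i}.Finite) (K : ℕ → Set P) : ℕ → ℤ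
  | 0 => ∑ p ∈ KFinset G hfin K 0, Rnum G 0 p
  | n + 1 =>
      (∑ p ∈ KFinset G hfin K n, Rnum G n p) - (∑ p ∈ obFinset G hfin n, Rnum G n p) +
        ∑ p ∈ KFinset G hfin K (n + 1), Rnum G (n + 1) p

/-- The sequence of functors `F_0 = c_ℤ, F_1, F_2, …` of Proposition 4.3, together with
the connecting short exact sequences `0 → F_{n-1} → Ker'_{F_{n-1}} → F_n → 0` and all
their properties. -/
structure CondensedSequence (G : GradedPoset P) (J : P → ℕ → Set P) : Type 1 where
  F : ℕ → PosetFunctor P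
  pi : ∀ n : ℕ, PosetHom (kerPrime G (F n) n) (F (n + 1))
  F_zero : F 0 = constZ P
  pi_surj : ∀ (n : ℕ) (p : P), Function.Surjective ((pi n).app p)
  pi_ker : ∀ (n : ℕ) (p : P), ((pi n).app p).ker = ((lambdaNT G (F n) n).app p).range
  condensed : ∀ n : ℕ, IsCondensed G (F n) n
  free : ∀ n : ℕ, IsFreeFunctor (F n)
  determined : ∀ n : ℕ, IsDetermined G J (F n) n
  rank_eq : ∀ (n : ℕ) (p : P), (n : ℤ) ≤ G.deg p →
    (Module.finrank ℤ ((F n).obj p) : ℤ) = Rnum G n p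

/-! ### Simplex-like posets -/

/-- The poset `Δ_n` of faces of the standard `n`-dimensional simplex, ordered by
inclusion: faces are the nonempty subsets of the vertex set. -/
def SimplexPoset (n : ℕ) : Type := {s : Finset (Fin (n + 1)) // s.Nonempty}

instance (n : ℕ) : PartialOrder (SimplexPoset n) := Subtype.partialOrder _

/-- A poset `P` is simplex-like (with dimension function `d`) if for every `p` the
category `(P ↓ p)` is isomorphic to `Δ_{d p}`. -/
def SimplexLike (P : Type) [PartialOrder P] (d : P → ℕ) : Prop :=
  ∀ p : P, Nonempty ({q : P // q ≤ p} ≃o SimplexPoset (d p))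

lemma aux_free_of_tf {M : Type} [AddCommGroup M] [Module.Finite ℤ M]
    (h : ∀ (m : ℤ) (x : M), m ≠ 0 → m • x = 0 → x = 0) : Module.Free ℤ M := by
  have : Module.IsTorsionFree ℤ M := by
    refine ⟨fun m hm x y hxy => ?_⟩
    have hm0 : m ≠ 0 := hm.ne_zero
    have := h m (x - y) hm0 (by rw [smul_sub]; exact sub_eq_zero.2 hxy)
    exact sub_eq_zero.1 this
  exact Module.free_of_finite_type_torsion_free'

lemma aux_tf {M : Type} [AddCommGroup M] [Module.Free ℤ M] (m : ℤ) (x : M) (hm : m ≠ 0)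
    (h : m • x = 0) : x = 0 := by
  rcases smul_eq_zero.1 h with h | h
  · exact absurd h hm
  · exact h

lemma aux_pure {A B : Type} [AddCommGroup A] [AddCommGroup B] [Module.Finite ℤ B] (f : A →+ B)
    (h : ∀ (m : ℤ) (b : B) (a : A), m ≠ 0 → f a = m • b → ∃ a', f a' = b) : IsPureHom f := by
  unfold IsPureHom
  have : Module.Finite ℤ (B ⧸ f.range) :=
    Module.Finite.of_surjective (QuotientAddGroup.mk' f.range).toIntLinearMap
      (QuotientAddGroup.mk'_surjective _)
  apply aux_free_of_tf
  intro m x hm hx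
  obtain ⟨b, rfl⟩ := QuotientAddGroup.mk'_surjective _ x
  rw [← map_zsmul] at hx
  obtain ⟨a, ha⟩ := (QuotientAddGroup.eq_zero_iff _).1 hx
  obtain ⟨a', ha'⟩ := h m b a hm ha
  exact (QuotientAddGroup.eq_zero_iff _).2 ⟨a', ha'⟩

lemma aux_surj {A B : Type} [AddCommGroup A] [AddCommGroup B] [Module.Finite ℤ B]
    (f : A →+ B) (hinj : Function.Injective f) (hp : IsPureHom f)
    (hr : Module.finrank ℤ A = Module.finrank ℤ B) : Function.Surjective f := by
  unfold IsPureHom at hp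
  let q : B →ₗ[ℤ] (B ⧸ f.range) := (QuotientAddGroup.mk' f.range).toIntLinearMap
  have hq : Function.Surjective q := QuotientAddGroup.mk'_surjective _
  have hfin : Module.Finite ℤ (B ⧸ f.range) := Module.Finite.of_surjective q hq
  have h1 := Submodule.finrank_quotient_add_finrank (LinearMap.ker q)
  rw [(q.quotKerEquivOfSurjective hq).finrank_eq] at h1
  have hk : LinearMap.ker q = LinearMap.range f.toIntLinearMap := by
    ext b
    exact QuotientAddGroup.eq_zero_iff b
  have h2 : Module.finrank ℤ (LinearMap.range f.toIntLinearMap) = Module.finrank ℤ A :=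
    LinearMap.finrank_range_of_inj (f := f.toIntLinearMap) hinj
  rw [hk, h2, hr] at h1
  have h3 : Module.finrank ℤ (B ⧸ f.range) = 0 := by omega
  have h4 : Subsingleton (B ⧸ f.range) := Module.finrank_zero_iff.1 h3
  intro b
  exact (QuotientAddGroup.eq_zero_iff (N := f.range) b).1 (Subsingleton.elim _ _)

lemma aux_deg_lt {P : Type} [PartialOrder P] (G : GradedPoset P) {p q : P} (h : p < q) :
    G.deg q < G.deg p := by
  have hf : {r : P | p < r ∧ r ≤ q}.Finite := (G.finite_up p).subset fun r hr => hr.1.le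
  obtain ⟨r, hr⟩ := hf.exists_minimal ⟨q, h, le_rfl⟩
  have hs := G.deg_step hr.prop.1 (fun t h1 h2 => by
    rcases h1.eq_or_lt with h1 | h1
    · exact Or.inl h1.symm
    · exact Or.inr (le_antisymm h2 (hr.2 ⟨h1, h2.trans hr.prop.2⟩ h2)))
  have := G.deg_antitone hr.prop.2
  omega

lemma aux_pi_finite {ι : Type} [Finite ι] (A : ι → Type) [∀ i, AddCommGroup (A i)]
    (h : ∀ i, Module.Finite ℤ (A i)) : Module.Finite ℤ (∀ i, A i) := by
  have := Module.Finite.pi (R := ℤ) (M := A)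
  convert this

lemma aux_finrank_pi {ι : Type} [Fintype ι] (A : ι → Type) [∀ i, AddCommGroup (A i)]
    (h : ∀ i, Module.Free ℤ (A i)) (h : ∀ i, Module.Finite ℤ (A i)) :
    Module.finrank ℤ (∀ i, A i) = ∑ i, Module.finrank ℤ (A i) := by
  have := Module.finrank_pi_fintype ℤ (M := A)
  convert this

lemma aux_bij {P : Type} [PartialOrder P] (G : GradedPoset P) (J : P → ℕ → Set P)
    (hJ : IsLCF G J) (F : PosetFunctor P) (n : ℕ)
    (hcond : IsCondensed G F n) (hfree : IsFreeFunctor F)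
    (hdet : IsDetermined G J F n)
    (hrank : ∀ p₀ : P, (n : ℤ) + 1 ≤ G.deg p₀ →
      (Module.finrank ℤ (F.obj p₀) : ℤ) =
        ∑ q ∈ JFinset G J p₀ n, (Module.finrank ℤ (F.obj q) : ℤ))
    (p : P) (hp : (n : ℤ) + 1 ≤ G.deg p) : Function.Bijective (detMap F p (J p n)) := by
  have hmain : Function.Injective (detMap F p (J p n)) ∧ IsPureHom (detMap F p (J p n)) := by
    rcases hp.eq_or_lt with h | h
    · exact (hdet.2 p h.symm).symm
    · obtain ⟨h1, h2⟩ := hdet.1 p h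
      refine ⟨?_, h2⟩
      rw [injective_iff_map_eq_zero]
      intro x hx
      apply hcond.2 p (by omega)
      intro q hq
      have := @h1 ⟨fun q => F.map q.2.le x, fun q r h => F.map_comp _ _ _⟩
        ⟨fun q => 0, fun q r h => map_zero _⟩ (by
          funext q
          exact congrFun hx ⟨q.1, q.2.1, q.2.2.le⟩)
      exact congrFun (congrArg Subtype.val this) ⟨q, hq⟩
  refine ⟨hmain.1, ?_⟩
  have hfin : (J p n ∩ {q : P | p ≤ q}).Finite := (G.finite_up p).inter_of_right _
  have : Fintype ↥(J p n ∩ {q : P | p ≤ q}) := hfin.fintype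
  have := aux_pi_finite (fun q : ↥(J p n ∩ {q : P | p ≤ q}) => F.obj q.1)
    (fun q => (hfree q.1).2)
  refine aux_surj _ hmain.1 hmain.2 ?_
  rw [aux_finrank_pi _ (fun q : ↥(J p n ∩ {q : P | p ≤ q}) => (hfree q.1).1)
    (fun q => (hfree q.1).2)]
  have h := hrank p hp
  rw [← Nat.cast_sum] at h
  rw [Nat.cast_inj.1 h]
  refine Finset.sum_subtype (p := fun q => q ∈ J p n ∩ {q : P | p ≤ q}) _ (fun q => ?_)
    (fun q => Module.finrank ℤ (F.obj q))
  simp [JFinset, and_comm]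

lemma aux_main {P : Type} [PartialOrder P] (G : GradedPoset P) (J : P → ℕ → Set P)
    (hJ : IsLCF G J) (F : PosetFunctor P) (n : ℕ)
    (hcond : IsCondensed G F n) (hfree : IsFreeFunctor F)
    (hdet : IsDetermined G J F n)
    (hbij : ∀ p : P, (n : ℤ) + 1 ≤ G.deg p → Function.Bijective (detMap F p (J p n)))
    (Gf : PosetFunctor P) (pr : ∀ p, (∀ q : degSet G p n, F.obj q.1) →+ Gf.obj p)
    (hnat : ∀ {p q : P} (h : p ≤ q) (x : ∀ r : degSet G p n, F.obj r.1),
      Gf.map h (pr p x) = pr q (fun r => x ⟨r.1, h.trans r.2.1, r.2.2⟩))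
    (hsurj : ∀ p₀ : P, Function.Surjective (pr p₀))
    (hker : ∀ (p : P) (x : ∀ r : degSet G p n, F.obj r.1),
      pr p x = 0 ↔ ∃ f : F.obj p, ∀ q : degSet G p n, F.map q.2.1 f = x q) :
    IsCondensed G Gf (n + 1) ∧ IsFreeFunctor Gf ∧ IsDetermined G J Gf (n + 1) := by
  -- elements of `J p n` lie in the degree set
  have hJd : ∀ {p q : P} {m : ℕ}, q ∈ J p m → q ∈ degSet G p m := fun h => hJ.1 _ _ h
  have hdl : ∀ {p q : P}, p < q → G.deg q < G.deg p := fun h => aux_deg_lt G h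
  -- uniqueness of normalised lifts
  have huniq : ∀ (p : P), (n : ℤ) + 1 ≤ G.deg p → ∀ x : (∀ r : degSet G p n, F.obj r.1),
      pr p x = 0 → (∀ q : degSet G p n, q.1 ∈ J p n → x q = 0) → x = 0 := by
    intro p hp x hx h0
    obtain ⟨f, hf⟩ := (hker p x).1 hx
    have hf0 : f = 0 := by
      apply (hbij p hp).1
      rw [map_zero]
      funext q
      have h1 := hf ⟨q.1, hJd q.2.1⟩
      rw [h0 _ q.2.1] at h1
      exact h1
    funext q
    rw [← hf q, hf0, map_zero]
    rfl
  -- existence of normalised lifts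
  have hlift : ∀ (p : P), (n : ℤ) + 1 ≤ G.deg p → ∀ y : Gf.obj p,
      ∃ x : (∀ r : degSet G p n, F.obj r.1), pr p x = y ∧
        ∀ q : degSet G p n, q.1 ∈ J p n → x q = 0 := by
    intro p hp y
    obtain ⟨x, rfl⟩ := hsurj p y
    obtain ⟨f, hf⟩ := (hbij p hp).2 (fun q => x ⟨q.1, hJd q.2.1⟩)
    let l : (∀ r : degSet G p n, F.obj r.1) := fun q => F.map q.2.1 f
    have hl : pr p l = 0 := (hker p l).2 ⟨f, fun _ => rfl⟩
    refine ⟨x - l, by rw [map_sub, hl, sub_zero], fun q hq => ?_⟩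
    have h1 : F.map q.2.1 f = x q := congrFun hf ⟨q.1, hq, q.2.1⟩
    simp only [Pi.sub_apply, l, h1, sub_self]
  have hlam : ∀ (p : P) (f : F.obj p), (∀ q : degSet G p n, F.map q.2.1 f = 0) → f = 0 := by
    intro p f hf
    rcases lt_trichotomy (G.deg p) n with h | h | h
    · exact hcond.1 p h f
    · rw [← F.map_id p f]
      exact hf ⟨p, le_rfl, h⟩
    · apply (hbij p (by omega)).1
      rw [map_zero]
      funext q
      exact hf ⟨q.1, hJd q.2.1⟩
  have hzero : ∀ p : P, G.deg p < ((n + 1 : ℕ) : ℤ) → ∀ x : Gf.obj p, x = 0 := by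
    intro p hp y
    push_cast at hp
    obtain ⟨x, rfl⟩ := hsurj p y
    rw [hker]
    by_cases h : G.deg p = n
    · refine ⟨x ⟨p, le_rfl, h⟩, ?_⟩
      rintro ⟨q, hq1, hq2⟩
      rcases hq1.eq_or_lt with e | e
      · subst e
        exact F.map_id _ _
      · have := hdl e
        omega
    · refine ⟨0, ?_⟩
      rintro ⟨q, hq1, hq2⟩
      have := G.deg_antitone hq1
      omega
  have hkerz : ∀ p : P, ((n + 1 : ℕ) : ℤ) < G.deg p → ∀ x ∈ kerAt Gf p, x = 0 := by
    intro p hp y hy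
    push_cast at hp
    obtain ⟨x, rfl⟩ := hsurj p y
    have h1 : ∀ q : {q : P | p < q}, ∃ f : F.obj q.1, ∀ r : degSet G q.1 n,
        F.map r.2.1 f = x ⟨r.1, (le_of_lt q.2).trans r.2.1, r.2.2⟩ := by
      intro q
      have := hy q.1 q.2
      rw [hnat, hker] at this
      exact this
    choose s hs using h1
    have hsec : s ∈ sectionsOnSet F {q : P | p < q} := by
      intro q r h
      rw [← sub_eq_zero]
      apply hlam
      intro t
      rw [map_sub, F.map_comp, hs r t, hs q ⟨t.1, h.trans t.2.1, t.2.2⟩, sub_self]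
    obtain ⟨f, hf⟩ := (hbij p (by omega)).2
      (fun q => s ⟨q.1, lt_of_le_of_ne q.2.2 (by
        intro e
        have h2 := (hJd q.2.1).2
        rw [← e] at h2
        omega)⟩)
    have := @(hdet.1 p (by omega)).1 ⟨fun q => F.map q.2.le f, fun q r h => F.map_comp _ _ _⟩
      ⟨s, hsec⟩ (by
        funext q
        exact congrFun hf ⟨q.1, q.2.1, q.2.2.le⟩)
    rw [hker]
    refine ⟨f, fun q => ?_⟩
    have hpq : p < q.1 := lt_of_le_of_ne q.2.1 (by
        intro e
        have h2 := q.2.2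
        rw [← e] at h2
        omega)
    have h3 : F.map q.2.1 f = s ⟨q.1, hpq⟩ := congrFun (congrArg Subtype.val this) ⟨q.1, hpq⟩
    rw [h3, ← F.map_id q.1 (s ⟨q.1, hpq⟩)]
    exact hs ⟨q.1, hpq⟩ ⟨q.1, le_rfl, q.2.2⟩
  have hGfree : IsFreeFunctor Gf := by
    intro p
    have : Finite (degSet G p n) := ((G.finite_up p).subset fun q hq => hq.1).to_subtype
    have := aux_pi_finite (fun q : degSet G p n => F.obj q.1) (fun q => (hfree q.1).2)
    have hfin : Module.Finite ℤ (Gf.obj p) :=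
      Module.Finite.of_surjective (pr p).toIntLinearMap (hsurj p)
    refine ⟨aux_free_of_tf fun m y hm hy => ?_, hfin⟩
    by_cases hp : (n : ℤ) + 1 ≤ G.deg p
    · obtain ⟨x, rfl, hx⟩ := hlift p hp y
      rw [← map_zsmul] at hy
      have h0 := huniq p hp _ hy (fun q hq => by rw [Pi.smul_apply, hx q hq, smul_zero])
      have : x = 0 := by
        funext q
        have := (hfree q.1).1
        exact aux_tf m (x q) hm (congrFun h0 q)
      rw [this, map_zero]
    · exact hzero p (by push_cast; omega) y
  -- covering
  have hcov : ∀ (p : P) (m : ℕ), (m : ℤ) < G.deg p → ∀ q ∈ degSet G p m,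
      ∃ r ∈ J p (m + 1), q ∈ degSet G r m := by
    intro p m hm q hq
    rw [← hJ.2.1 p m hm] at hq
    simpa using hq
  have hinj : ∀ p : P, (n : ℤ) + 2 ≤ G.deg p →
      Function.Injective (detMap Gf p (J p (n + 1))) := by
    intro p hp
    rw [injective_iff_map_eq_zero]
    intro y hy
    obtain ⟨x, rfl, hx⟩ := hlift p (by omega) y
    have : x = 0 := by
      funext q
      obtain ⟨r, hr, hqr⟩ := hcov p n (by omega) q.1 q.2
      have h1 : Gf.map (hJd hr).1 (pr p x) = 0 := congrFun hy ⟨r, hr, (hJd hr).1⟩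
      rw [hnat] at h1
      have hrd := (hJd hr).2
      push_cast at hrd
      have h2 := huniq r (by omega) _ h1 (fun t ht => hx _ (hJ.2.2 p n r hr ht))
      exact congrFun h2 ⟨q.1, hqr⟩
    rw [this, map_zero]
  have hpure : ∀ p : P, (n : ℤ) + 2 ≤ G.deg p → IsPureHom (detMap Gf p (J p (n + 1))) := by
    intro p hp
    have : Finite ↥(J p (n + 1) ∩ {q : P | p ≤ q}) :=
      ((G.finite_up p).inter_of_right _).to_subtype
    have := aux_pi_finite (fun q : ↥(J p (n + 1) ∩ {q : P | p ≤ q}) => Gf.obj q.1)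
      (fun q => (hGfree q.1).2)
    apply aux_pure
    intro m z y hm hy
    obtain ⟨x, rfl, hx⟩ := hlift p (by omega) y
    have hJdeg : ∀ r ∈ J p (n + 1), (n : ℤ) + 1 ≤ G.deg r := by
      intro r hr
      have := (hJd hr).2
      push_cast at this
      omega
    have h1 : ∀ r : ↥(J p (n + 1) ∩ {q : P | p ≤ q}),
        ∃ w : (∀ t : degSet G r.1 n, F.obj t.1), pr r.1 w = z r ∧
          ∀ t : degSet G r.1 n, x ⟨t.1, r.2.2.trans t.2.1, t.2.2⟩ = m • w t := by
      intro r
      obtain ⟨w, hw, hw0⟩ := hlift r.1 (hJdeg _ r.2.1) (z r)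
      refine ⟨w, hw, ?_⟩
      have h2 : Gf.map r.2.2 (pr p x) = m • z r := congrFun hy r
      rw [hnat, ← hw, ← map_zsmul, ← sub_eq_zero, ← map_sub] at h2
      have h3 := huniq r.1 (hJdeg _ r.2.1) _ h2 (fun t ht => by
        rw [Pi.sub_apply, Pi.smul_apply, hw0 t ht, smul_zero, sub_zero]
        exact hx _ (hJ.2.2 p n r.1 r.2.1 ht))
      intro t
      exact sub_eq_zero.1 (congrFun h3 t)
    choose w hw hwx using h1
    have h4 : ∀ q : degSet G p n, ∃ u : F.obj q.1, x q = m • u := by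
      intro q
      obtain ⟨r, hr, hqr⟩ := hcov p n (by omega) q.1 q.2
      exact ⟨_, hwx ⟨r, hr, (hJd hr).1⟩ ⟨q.1, hqr⟩⟩
    choose u hu using h4
    refine ⟨pr p u, ?_⟩
    funext r
    change Gf.map r.2.2 (pr p u) = z r
    rw [hnat, ← hw r]
    congr 1
    funext t
    have := (hfree t.1).1
    rw [← sub_eq_zero]
    apply aux_tf m _ hm
    rw [smul_sub, ← hwx r t, ← hu, sub_self]
  refine ⟨⟨hzero, hkerz⟩, hGfree, ?_, ?_⟩
  · intro p hp
    push_cast at hp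
    refine ⟨?_, hpure p (by omega)⟩
    intro a b hab
    have key : ∀ (k : ℕ) (q : P) (hq : p < q), G.deg q < k → a.1 ⟨q, hq⟩ - b.1 ⟨q, hq⟩ = 0 := by
      intro k
      induction k with
      | zero =>
        intro q hq h
        have := G.deg_nonneg q
        simp at h
        omega
      | succ k ih =>
        intro q hq h
        push_cast at h
        rcases lt_trichotomy (G.deg q) ((n : ℤ) + 1) with h1 | h1 | h1
        · exact hzero q (by push_cast; omega) _
        · obtain ⟨r, hr, hqr⟩ := hcov p (n + 1) (by push_cast; omega) q
            ⟨hq.le, by push_cast; omega⟩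
          have hrd := (hJd hr).2
          push_cast at hrd
          have hpr : p < r := lt_of_le_of_ne (hJd hr).1 (by
            intro e
            rw [← e] at hrd
            omega)
          have h5 : a.1 ⟨r, hpr⟩ - b.1 ⟨r, hpr⟩ = 0 := by
            apply hinj r (by omega)
            rw [map_zero]
            funext t
            change Gf.map t.2.2 _ = 0
            have hpt : p < t.1 := lt_of_lt_of_le hpr t.2.2
            rw [map_sub, a.2 ⟨r, hpr⟩ ⟨t.1, hpt⟩ t.2.2, b.2 ⟨r, hpr⟩ ⟨t.1, hpt⟩ t.2.2,
              sub_eq_zero]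
            exact congrFun hab ⟨t.1, hJ.2.2 p (n + 1) r hr t.2.1, hpt⟩
          rw [← a.2 ⟨r, hpr⟩ ⟨q, hq⟩ hqr.1, ← b.2 ⟨r, hpr⟩ ⟨q, hq⟩ hqr.1, ← map_sub, h5, map_zero]
        · apply hkerz q (by push_cast; omega)
          intro r hqr
          have := hdl hqr
          rw [map_sub, a.2 ⟨q, hq⟩ ⟨r, hq.trans hqr⟩ hqr.le, b.2 ⟨q, hq⟩ ⟨r, hq.trans hqr⟩ hqr.le]
          exact ih r (hq.trans hqr) (by omega)
    apply Subtype.ext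
    funext q
    rw [← sub_eq_zero]
    refine key ((G.deg q.1).toNat + 1) q.1 q.2 ?_
    have := G.deg_nonneg q.1
    omega
  · intro p hp
    push_cast at hp
    exact ⟨hpure p (by omega), hinj p (by omega)⟩

/-- **Proposition 3.6.** Let `𝒫` be a graded poset and `𝒥` a local covering family.
Assume `F : 𝒫 → Ab` is `n`-condensed, free and `𝒥`-determined, and consider the functor
`G` defined by the short exact sequence `0 → F → Ker'_F → G → 0`. If for each object
`p₀` with `deg p₀ ≥ n+1` one has `rk F(p₀) = Σ_{p ∈ J_n^{p₀}} rk F(p)`, then `G` is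
`(n+1)`-condensed, free and `𝒥`-determined. -/
theorem prop_3_6 {P : Type} [PartialOrder P] (G : GradedPoset P) (J : P → ℕ → Set P)
    (hJ : IsLCF G J) (F : PosetFunctor P) (n : ℕ)
    (hcond : IsCondensed G F n) (hfree : IsFreeFunctor F)
    (hdet : IsDetermined G J F n)
    (Gf : PosetFunctor P) (π : PosetHom (kerPrime G F n) Gf)
    (hsurj : ∀ p₀ : P, Function.Surjective (π.app p₀))
    (hker : ∀ p₀ : P, (π.app p₀).ker = ((lambdaNT G F n).app p₀).range)
    (hrank : ∀ p₀ : P, (n : ℤ) + 1 ≤ G.deg p₀ →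
      (Module.finrank ℤ (F.obj p₀) : ℤ) =
        ∑ q ∈ JFinset G J p₀ n, (Module.finrank ℤ (F.obj q) : ℤ)) :
    IsCondensed G Gf (n + 1) ∧ IsFreeFunctor Gf ∧ IsDetermined G J Gf (n + 1) := by
  refine aux_main G J hJ F n hcond hfree hdet
    (aux_bij G J hJ F n hcond hfree hdet hrank) Gf (fun p => π.app p)
    (fun h x => π.naturality h x) hsurj ?_
  intro p x
  have h : x ∈ (π.app p).ker ↔ x ∈ ((lambdaNT G F n).app p).range := by rw [hker p]
  refine Iff.trans h ⟨?_, ?_⟩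
  · rintro ⟨f, hf⟩
    exact ⟨f, fun q => congrFun hf q⟩
  · rintro ⟨f, hf⟩
    exact ⟨f, funext hf⟩
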